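/- Let σ > 0, β > 0, c ∈ (−1, 1), and let φ : ℝ → ℝ be a bounded measurable function. Write g_β(t) = √(β/(2π))·exp(−βt²/2), let (φ ∗ g_β)(z) = ∫ φ(z − t)·g_β(t) dt, let p(z₁, z₂) = (1/(2πσ²√(1 − c²)))·exp(−(z₁² − 2c·z₁z₂ + z₂²)/(2σ²(1 − c²))) be the centered bivariate Gaussian density with covariance matrix [[σ², cσ²], [cσ², σ²]], set s² = σ² + 1/β, and let q(w₁, w₂) = (1/(2π√(s⁴ − c²σ⁴)))·exp(−(s²w₁² − 2cσ²·w₁w₂ + s²w₂²)/(2(s⁴ − c²σ⁴))) be the centered bivariate Gaussian density with covariance matrix [[s², cσ²], [cσ², s²]]. Then ∬_{ℝ²} (φ ∗ g_β)(z₁)·(φ ∗ g_β)(z₂)·p(z₁, z₂) dz₁ dz₂ = ∬_{ℝ²} φ(w₁)·φ(w₂)·q(w₁, w₂) dw₁ dw₂. -/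

import Mathlib

open Real MeasureTheory

/-- The Gaussian integral of the exponential of a quadratic polynomial. -/
theorem integral_exp_neg_mul_sq_add_linear {a : ℝ} (ha : 0 < a) (b d : ℝ) :
    ∫ x : ℝ, exp (-a * x ^ 2 + b * x + d) = √(π / a) * exp (b ^ 2 / (4 * a) + d) := by
  have h : ∀ x : ℝ, exp (-a * x ^ 2 + b * x + d) =
      exp (-a * (x - b / (2 * a)) ^ 2) * exp (b ^ 2 / (4 * a) + d) := fun x => by
    rw [← exp_add]
    congr 1
    field_simp
    ring
  simp_rw [h]
  rw [integral_mul_const, integral_sub_right_eq_self (fun x : ℝ => exp (-a * x ^ 2)),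
    integral_gaussian]

theorem integral_integral_exp_quadratic {a h : ℝ} (ha : 0 < a) (hD : 0 < a ^ 2 - h ^ 2)
    (b₁ b₂ d : ℝ) :
    ∫ x : ℝ, ∫ y : ℝ, exp (-(a * x ^ 2 - 2 * h * x * y + a * y ^ 2) + b₁ * x + b₂ * y + d) =
      π / √(a ^ 2 - h ^ 2) *
        exp ((a * b₁ ^ 2 + 2 * h * b₁ * b₂ + a * b₂ ^ 2) / (4 * (a ^ 2 - h ^ 2)) + d) := by
  have inner : ∀ x : ℝ,
      ∫ y : ℝ, exp (-(a * x ^ 2 - 2 * h * x * y + a * y ^ 2) + b₁ * x + b₂ * y + d) =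
        √(π / a) * exp (-((a ^ 2 - h ^ 2) / a) * x ^ 2 + (b₁ + h * b₂ / a) * x +
          (b₂ ^ 2 / (4 * a) + d)) := fun x => by
    have e : ∀ y : ℝ, -(a * x ^ 2 - 2 * h * x * y + a * y ^ 2) + b₁ * x + b₂ * y + d =
        -a * y ^ 2 + (b₂ + 2 * h * x) * y + (-a * x ^ 2 + b₁ * x + d) := fun y => by ring
    simp_rw [e]
    rw [integral_exp_neg_mul_sq_add_linear ha]
    congr 2
    field_simp
    ring
  simp_rw [inner]
  rw [integral_const_mul, integral_exp_neg_mul_sq_add_linear (by positivity), ← mul_assoc,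
    ← sqrt_mul (by positivity)]
  congr 1
  · rw [show π / a * (π / ((a ^ 2 - h ^ 2) / a)) = π ^ 2 / (a ^ 2 - h ^ 2) by field_simp,
      sqrt_div (by positivity), sqrt_sq pi_pos.le]
  · have := hD.ne'
    congr 1
    field_simp
    ring

theorem integrable_exp_neg_quadratic {c k : ℝ} (hc : |c| < 1) (hk : 0 < k) :
    Integrable fun z : ℝ × ℝ => exp (-(z.1 ^ 2 - 2 * c * z.1 * z.2 + z.2 ^ 2) / k) := by
  have hb : 0 < (1 - |c|) / k := div_pos (by linarith) hk
  refine ((integrable_exp_neg_mul_sq hb).mul_prod (integrable_exp_neg_mul_sq hb)).mono'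
    (by fun_prop) (ae_of_all _ fun z => ?_)
  rw [norm_eq_abs, abs_exp, ← exp_add, exp_le_exp]
  have h1 : 2 * c * z.1 * z.2 ≤ |c| * (z.1 ^ 2 + z.2 ^ 2) := by
    have h := neg_abs_le c
    have h' := le_abs_self c
    nlinarith [mul_nonneg (by linarith : 0 ≤ |c| + c) (sq_nonneg (z.1 - z.2)),
      mul_nonneg (by linarith : 0 ≤ |c| - c) (sq_nonneg (z.1 + z.2))]
  rw [show -((1 - |c|) / k) * z.1 ^ 2 + -((1 - |c|) / k) * z.2 ^ 2 =
    -((1 - |c|) * (z.1 ^ 2 + z.2 ^ 2)) / k by ring]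
  gcongr
  linarith

/-- Exchanging the order of integration: a density `P` tested against a smoothed function equals
the smoothed density tested against the function. -/
theorem integral_mul_integral_smoothing {P G Φ : ℝ × ℝ → ℝ} (hP : Integrable P)
    (hG : Integrable G) (hΦ : Measurable Φ) {C : ℝ} (hC : ∀ w, |Φ w| ≤ C) :
    (∫ z₁ : ℝ, ∫ z₂ : ℝ, (∫ w, Φ w * G (w - (z₁, z₂))) * P (z₁, z₂)) =
      ∫ w₁ : ℝ, ∫ w₂ : ℝ, Φ (w₁, w₂) *
        ∫ z₁ : ℝ, ∫ z₂ : ℝ, P (z₁, z₂) * G ((w₁, w₂) - (z₁, z₂)) := by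
  have hH : Integrable (fun x : (ℝ × ℝ) × (ℝ × ℝ) => P x.2 * G (x.1 - x.2))
      (volume.prod volume) := by
    simpa using hP.convolution_integrand (ContinuousLinearMap.mul ℝ ℝ) hG
  have hF : Integrable (fun x : (ℝ × ℝ) × (ℝ × ℝ) => Φ x.1 * (P x.2 * G (x.1 - x.2)))
      (volume.prod volume) :=
    hH.bdd_mul (c := C) (hΦ.comp measurable_fst).aestronglyMeasurable (ae_of_all _ fun x => hC x.1)
  have hL : ∀ z, (∫ w, Φ w * G (w - z)) * P z = ∫ w, Φ w * (P z * G (w - z)) := fun z => by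
    rw [← integral_mul_const]
    congr 1 with w
    ring
  have hR : (fun w => ∫ z, Φ w * (P z * G (w - z))) =ᵐ[volume]
      fun w => Φ w * ∫ z₁ : ℝ, ∫ z₂ : ℝ, P (z₁, z₂) * G (w - (z₁, z₂)) := by
    filter_upwards [hH.prod_right_ae] with w hw
    rw [integral_const_mul, Measure.volume_eq_prod, integral_prod _ hw]
  have hLi := hF.integral_prod_right
  have hRi := hF.integral_prod_left.congr hR
  simp_rw [hL]
  rw [← integral_prod _ hLi, ← integral_prod _ hRi]
  exact (integral_integral_swap hF).symm.trans (integral_congr_ae hR)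

/-- The convolution of a centered bivariate Gaussian density of covariance
`[[σ², cσ²], [cσ², σ²]]` with an isotropic one of variance `1 / β`. -/
theorem integral_integral_gaussian_mul_gaussian {σ β c : ℝ} (hσ : 0 < σ) (hβ : 0 < β)
    (hc : 0 < 1 - c ^ 2) {s2 : ℝ} (hs2 : s2 = σ ^ 2 + 1 / β) (w₁ w₂ : ℝ) :
    ∫ z₁ : ℝ, ∫ z₂ : ℝ,
      (1 / (2 * π * σ ^ 2 * √(1 - c ^ 2)) *
        exp (-(z₁ ^ 2 - 2 * c * z₁ * z₂ + z₂ ^ 2) / (2 * σ ^ 2 * (1 - c ^ 2)))) *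
      ((√(β / (2 * π)) * exp (-β * (w₁ - z₁) ^ 2 / 2)) *
        (√(β / (2 * π)) * exp (-β * (w₂ - z₂) ^ 2 / 2))) =
    1 / (2 * π * √(s2 ^ 2 - c ^ 2 * σ ^ 4)) *
      exp (-(s2 * w₁ ^ 2 - 2 * c * σ ^ 2 * w₁ * w₂ + s2 * w₂ ^ 2) /
        (2 * (s2 ^ 2 - c ^ 2 * σ ^ 4))) := by
  obtain ⟨e, he⟩ : ∃ e, e = 1 - c ^ 2 := ⟨_, rfl⟩
  rw [← he] at hc ⊢
  have hc2 : c ^ 2 = 1 - e := by linarith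
  obtain ⟨a, ha⟩ : ∃ a, a = β / 2 + 1 / (2 * σ ^ 2 * e) := ⟨_, rfl⟩
  obtain ⟨h, hh⟩ : ∃ h, h = c / (2 * σ ^ 2 * e) := ⟨_, rfl⟩
  have ha0 : 0 < a := by rw [ha]; positivity
  have hD : a ^ 2 - h ^ 2 = β ^ 2 / 4 + β / (2 * σ ^ 2 * e) + 1 / (4 * σ ^ 4 * e) := by
    rw [ha, hh, div_pow, hc2]
    field_simp
    ring
  have hD0 : 0 < a ^ 2 - h ^ 2 := by rw [hD]; positivity
  have hE : s2 ^ 2 - c ^ 2 * σ ^ 4 = (2 * σ ^ 2 / β) ^ 2 * e * (a ^ 2 - h ^ 2) := by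
    rw [hD, hs2, hc2]
    field_simp
    ring
  have key : ∀ z₁ z₂ : ℝ,
      (1 / (2 * π * σ ^ 2 * √e) *
        exp (-(z₁ ^ 2 - 2 * c * z₁ * z₂ + z₂ ^ 2) / (2 * σ ^ 2 * e))) *
      ((√(β / (2 * π)) * exp (-β * (w₁ - z₁) ^ 2 / 2)) *
        (√(β / (2 * π)) * exp (-β * (w₂ - z₂) ^ 2 / 2))) =
      (1 / (2 * π * σ ^ 2 * √e) * (β / (2 * π))) *
        exp (-(a * z₁ ^ 2 - 2 * h * z₁ * z₂ + a * z₂ ^ 2) + (β * w₁) * z₁ + (β * w₂) * z₂ +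
          -(β / 2) * (w₁ ^ 2 + w₂ ^ 2)) := fun z₁ z₂ => by
    have hx : -(a * z₁ ^ 2 - 2 * h * z₁ * z₂ + a * z₂ ^ 2) + (β * w₁) * z₁ + (β * w₂) * z₂ +
          -(β / 2) * (w₁ ^ 2 + w₂ ^ 2) =
        -(z₁ ^ 2 - 2 * c * z₁ * z₂ + z₂ ^ 2) / (2 * σ ^ 2 * e) +
          (-β * (w₁ - z₁) ^ 2 / 2 + -β * (w₂ - z₂) ^ 2 / 2) := by
      rw [ha, hh]
      field_simp
      ring
    have hr := mul_self_sqrt (show 0 ≤ β / (2 * π) by positivity)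
    rw [hx, exp_add, exp_add]
    nth_rewrite 3 [← hr]
    generalize √(β / (2 * π)) = r
    ring
  simp_rw [key, integral_const_mul]
  rw [integral_integral_exp_quadratic ha0 hD0, ← mul_assoc]
  congr 1
  · rw [hE, sqrt_mul (by positivity), sqrt_mul (by positivity), sqrt_sq (by positivity)]
    have := sqrt_pos.2 hD0
    have := sqrt_pos.2 hc
    field_simp
  · congr 1
    have hs : s2 = 2 * σ ^ 4 * e * (2 * (a ^ 2 - h ^ 2) / β - a) := by
      rw [hD, ha, hs2]
      field_simp
      ring
    have hch : c = 2 * σ ^ 2 * e * h := by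
      rw [hh]
      field_simp
    rw [hE, hs, hch]
    generalize a ^ 2 - h ^ 2 = Δ at hD0
    field_simp
    ring

/-- τ-transform identity: evaluating the τ-transform of the Gaussian-smoothed
activation `φ ∗ g_β` under the centered bivariate Gaussian with covariance
`[[σ², cσ²], [cσ², σ²]]` equals the τ-transform of `φ` itself under the centered
bivariate Gaussian with covariance `[[σ²+1/β, cσ²], [cσ², σ²+1/β]]`. -/
theorem tau_transform_gaussian_smoothing
    (σ β c : ℝ) (hσ : 0 < σ) (hβ : 0 < β) (hc : c ∈ Set.Ioo (-1 : ℝ) 1)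
    (φ : ℝ → ℝ) (hφm : Measurable φ) (hφb : ∃ C : ℝ, ∀ x : ℝ, |φ x| ≤ C)
    (g : ℝ → ℝ) (hg : ∀ t : ℝ, g t = Real.sqrt (β / (2 * π)) * Real.exp (-β * t ^ 2 / 2))
    (conv : ℝ → ℝ) (hconv : ∀ z : ℝ, conv z = ∫ t : ℝ, φ (z - t) * g t)
    (p : ℝ → ℝ → ℝ)
    (hp : ∀ z₁ z₂ : ℝ, p z₁ z₂ =
      1 / (2 * π * σ ^ 2 * Real.sqrt (1 - c ^ 2)) *
        Real.exp (-(z₁ ^ 2 - 2 * c * z₁ * z₂ + z₂ ^ 2) / (2 * σ ^ 2 * (1 - c ^ 2))))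
    (s2 : ℝ) (hs2 : s2 = σ ^ 2 + 1 / β)
    (q : ℝ → ℝ → ℝ)
    (hq : ∀ w₁ w₂ : ℝ, q w₁ w₂ =
      1 / (2 * π * Real.sqrt (s2 ^ 2 - c ^ 2 * σ ^ 4)) *
        Real.exp (-(s2 * w₁ ^ 2 - 2 * c * σ ^ 2 * w₁ * w₂ + s2 * w₂ ^ 2) /
          (2 * (s2 ^ 2 - c ^ 2 * σ ^ 4)))) :
    ∫ z₁ : ℝ, ∫ z₂ : ℝ, conv z₁ * conv z₂ * p z₁ z₂ =
      ∫ w₁ : ℝ, ∫ w₂ : ℝ, φ w₁ * φ w₂ * q w₁ w₂ := by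
  obtain ⟨C, hC⟩ := hφb
  have hc2 : 0 < 1 - c ^ 2 := by nlinarith [hc.1, hc.2]
  have hgi : Integrable g := by
    rw [show g = fun t => √(β / (2 * π)) * exp (-(β / 2) * t ^ 2) from
      funext fun t => by rw [hg]; congr 2; ring]
    exact (integrable_exp_neg_mul_sq (by positivity)).const_mul _
  have hpi : Integrable fun z : ℝ × ℝ => p z.1 z.2 := by
    simp_rw [hp]
    exact (integrable_exp_neg_quadratic (abs_lt.2 hc) (by positivity)).const_mul _
  have hconv' : ∀ z, conv z = ∫ w, φ w * g (w - z) := fun z => by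
    rw [hconv, ← integral_sub_left_eq_self (fun w => φ w * g (w - z)) volume z]
    congr 1 with t
    rw [show z - t - z = -t by ring, hg, hg, neg_sq]
  have hprod : ∀ z₁ z₂, conv z₁ * conv z₂ =
      ∫ w : ℝ × ℝ, (φ w.1 * φ w.2) * (g (w - (z₁, z₂)).1 * g (w - (z₁, z₂)).2) :=
    fun z₁ z₂ => by
      rw [hconv', hconv', ← integral_prod_mul]
      congr 1 with w
      simp only [Prod.fst_sub, Prod.snd_sub]
      ring
  simp_rw [hprod]
  refine (integral_mul_integral_smoothing hpi (G := fun w => g w.1 * g w.2)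
    (Φ := fun w => φ w.1 * φ w.2) (C := C * C) (hgi.mul_prod hgi) (by fun_prop)
    fun w => ?_).trans ?_
  · rw [abs_mul]
    exact mul_le_mul (hC _) (hC _) (abs_nonneg _) ((abs_nonneg _).trans (hC 0))
  · congr 1 with w₁
    congr 1 with w₂
    congr 1
    simp only [hp, hg, hq, Prod.mk_sub_mk]
    exact integral_integral_gaussian_mul_gaussian hσ hβ hc2 hs2 w₁ w₂
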